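/- On Kreimer's Hopf algebra H_K, the derivations P and N satisfy the commutation relation [P,N] = D; that is, P(N(u)) − N(P(u)) = D(u) for all u ∈ H_K, where D is the derivation that multiplies each homogeneous element of degree n by n. -/

import Mathlib

attribute [local instance] Classical.propDecidable

inductive PlanarTree : Type where
  | node : List PlanarTree → PlanarTree

namespace PlanarTree

/-- Isomorphism of (planar representatives of) rooted trees: the lists of
principal branches match up, pairwise isomorphically, after a permutation. -/
inductive Iso : PlanarTree → PlanarTree → Prop where
  | node {l m l' : List PlanarTree} :
      List.Perm l m → List.Forall₂ Iso m l' → Iso (node l) (node l')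

/-- Number of vertices. -/
def size : PlanarTree → ℕ
  | node l => 1 + (l.attach.map fun c => size c.1).sum
decreasing_by simp only [PlanarTree.node.sizeOf_spec]; exact Nat.lt_of_lt_of_le (List.sizeOf_lt_of_mem c.2) (Nat.le_add_left _ _)

mutual
  /-- All trees obtained by attaching the root of `s` by a new edge to some vertex. -/
  def graftList (s : PlanarTree) : PlanarTree → List PlanarTree
    | node l => node (s :: l) :: (graftAux s l).map node
  def graftAux (s : PlanarTree) : List PlanarTree → List (List PlanarTree)
    | [] => []
    | a :: l => ((graftList s a).map (· :: l)) ++ (graftAux s l).map (a :: ·)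
end

/-- All trees obtained by adding a new edge and terminal vertex at some vertex. -/
def growList (t : PlanarTree) : List PlanarTree := graftList (node []) t

mutual
  /-- All trees obtained by deleting one (non-root) terminal vertex. -/
  def pruneList : PlanarTree → List PlanarTree
    | node l => (pruneAux l).map node
  def pruneAux : List PlanarTree → List (List PlanarTree)
    | [] => []
    | a :: l =>
        (match a with | node [] => [l] | _ => []) ++
        ((pruneList a).map (· :: l)) ++ (pruneAux l).map (a :: ·)
end

mutual
  /-- All pairs (cut-off subtree, remaining tree) obtained by cutting one edge. -/
  def cutPairs : PlanarTree → List (PlanarTree × PlanarTree)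
    | node l => (cutAux l).map fun x => (x.1, node x.2)
  def cutAux : List PlanarTree → List (PlanarTree × List PlanarTree)
    | [] => []
    | a :: l =>
        (a, l) :: (((cutPairs a).map fun x => (x.1, x.2 :: l)) ++
          (cutAux l).map fun x => (x.1, a :: x.2))
end

/-- The order of the symmetry group `SG(t)`: the product over all vertices `v`
of the number of permutations of the branches at `v` exchanging isomorphic branches. -/
noncomputable def sg : PlanarTree → ℕ
  | node l =>
      (l.attach.map fun c => sg c.1).prod *
        Nat.card {σ : Equiv.Perm (Fin l.length) // ∀ i, Iso (l.get (σ i)) (l.get i)}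
decreasing_by simp only [PlanarTree.node.sizeOf_spec]; exact Nat.lt_of_lt_of_le (List.sizeOf_lt_of_mem c.2) (Nat.le_add_left _ _)

/-- Vertices of a planar tree, encoded as paths of child-indices from the root. -/
inductive IsVertex : PlanarTree → List ℕ → Prop where
  | root (t : PlanarTree) : IsVertex t []
  | child {l : List PlanarTree} {i : ℕ} {c : PlanarTree} {p : List ℕ} :
      l[i]? = some c → IsVertex c p → IsVertex (node l) (i :: p)

def Vertex (t : PlanarTree) : Type := {p : List ℕ // IsVertex t p}

/-- `v` lies strictly below `w` in the tree order (i.e. `w` is a proper ancestor of `v`). -/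
def StrictBelow {t : PlanarTree} (v w : Vertex t) : Prop := w.1 <+: v.1 ∧ w.1 ≠ v.1

/-- A labelling of `t`. -/
def Labelling (t : PlanarTree) : Type :=
  {f : Vertex t ≃ Fin t.size // ∀ v w, StrictBelow v w → f w < f v}

/-- Equivalence of labellings: they differ by an automorphism of the rooted tree. -/
def labelEquiv {t : PlanarTree} (f g : Labelling t) : Prop :=
  ∃ φ : Equiv.Perm (Vertex t),
    (∀ v w, StrictBelow (φ v) (φ w) ↔ StrictBelow v w) ∧ ∀ v, f.1 (φ v) = g.1 v

end PlanarTree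

/-- Rooted trees: isomorphism classes of planar rooted trees. -/
instance planarSetoid : Setoid PlanarTree := Relation.EqvGen.setoid PlanarTree.Iso

def RTree : Type := Quotient planarSetoid

namespace RTree

def mk (p : PlanarTree) : RTree := ⟦p⟧

/-- A chosen planar representative. -/
noncomputable def rep (T : RTree) : PlanarTree := Quotient.out T

noncomputable def size (T : RTree) : ℕ := T.rep.size

/-- The order of the symmetry (automorphism) group of `T`. -/
noncomputable def sg (T : RTree) : ℕ := T.rep.sg

/-- The one-vertex tree. -/
def bullet : RTree := mk (PlanarTree.node [])

/-- `Covers T T'` means `T ⊲ T'`: `T` is obtained from `T'` by deleting one terminal vertex. -/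
noncomputable def Covers (T T' : RTree) : Prop :=
  ∃ p ∈ T'.rep.pruneList, mk p = T

/-- `n(T;T')`: the number of vertices of `T` to which a new edge can be added to obtain `T'`. -/
noncomputable def nCov (T T' : RTree) : ℕ :=
  T.rep.growList.countP fun p => decide (mk p = T')

/-- `m(T;T')`: the number of (terminal) edges of `T'` which when removed leave `T`. -/
noncomputable def mCov (T T' : RTree) : ℕ :=
  T'.rep.pruneList.countP fun p => decide (mk p = T)

/-- `n(T₁,T₂;T₃)`: the number of vertices of `T₂` such that attaching the root of `T₁`
there by a new edge yields `T₃`. -/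
noncomputable def nTri (T₁ T₂ T₃ : RTree) : ℕ :=
  (PlanarTree.graftList T₁.rep T₂.rep).countP fun p => decide (mk p = T₃)

/-- `m(T₁,T₂;T₃)`: the number of edges of `T₃` whose removal cuts off a subtree
isomorphic to `T₁` leaving `T₂` (the piece containing the root). -/
noncomputable def mTri (T₁ T₂ T₃ : RTree) : ℕ :=
  T₃.rep.cutPairs.countP fun x => decide (mk x.1 = T₁ ∧ mk x.2 = T₂)

end RTree

section Ops

variable (k : Type*) [Semiring k]

/-- The element `𝔑(T) = Σ_{T ⊲ T'} n(T;T')·T'` of `k{T}`. -/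
noncomputable def growF (T : RTree) : RTree →₀ k :=
  (T.rep.growList.map fun p => Finsupp.single (RTree.mk p) (1 : k)).sum

/-- The element `𝔓(T) = Σ_{T' ⊲ T} m(T';T)·T'` of `k{T}`. -/
noncomputable def pruneF (T : RTree) : RTree →₀ k :=
  (T.rep.pruneList.map fun p => Finsupp.single (RTree.mk p) (1 : k)).sum

/-- The growth operator `𝔑` on `k{T}`. -/
noncomputable def Grow : Module.End k (RTree →₀ k) :=
  Finsupp.linearCombination k (growF k)

/-- The pruning operator `𝔓` on `k{T}`. -/
noncomputable def Prune : Module.End k (RTree →₀ k) :=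
  Finsupp.linearCombination k (pruneF k)

/-- The operator `𝔇` on `k{T}`, `𝔇(t) = |t|·t`. -/
noncomputable def Diag : Module.End k (RTree →₀ k) :=
  Finsupp.linearCombination k fun T => (T.size : k) • Finsupp.single T 1

/-- The inner product on `k{T}` determined by `(t,t') = |SG(t)|·δ_{t,t'}`. -/
noncomputable def innerT (x y : RTree →₀ k) : k :=
  x.sum fun T c => c * y T * (T.sg : k)

/-- Generalized multiplicity `n(T;T')`: coefficient of `T'` in `𝔑^{|T'|-|T|}(T)`. -/
noncomputable def nGen (T T' : RTree) : k :=
  ((Grow k ^ (T'.size - T.size)) (Finsupp.single T 1)) T'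

/-- Generalized multiplicity `m(T;T')`: coefficient of `T` in `𝔓^{|T'|-|T|}(T')`. -/
noncomputable def mGen (T T' : RTree) : k :=
  ((Prune k ^ (T'.size - T.size)) (Finsupp.single T' 1)) T

end Ops

section Kreimer

variable (k : Type*) [CommSemiring k]

/-- Kreimer's Hopf algebra `H_K`, as a commutative algebra: the free polynomial
algebra on rooted trees. -/
abbrev HK := MvPolynomial RTree k

/-- The inclusion `k{T} → H_K` of the linear span of the variables. -/
noncomputable def toHK : (RTree →₀ k) →ₗ[k] HK k :=
  Finsupp.linearCombination k fun T => MvPolynomial.X T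

/-- The growth derivation `N` on `H_K`, with `N(t) = 𝔑(t)` for rooted trees `t`. -/
noncomputable def ND : Derivation k (HK k) (HK k) :=
  MvPolynomial.mkDerivation k fun T => toHK k (growF k T)

/-- The pruning derivation `P` on `H_K`, with `P(t) = 𝔓(t)` for `|t| ≥ 2`, `P(•) = 1`. -/
noncomputable def PD : Derivation k (HK k) (HK k) :=
  MvPolynomial.mkDerivation k fun T =>
    if T = RTree.bullet then 1 else toHK k (pruneF k T)

/-- The grading derivation `D` on `H_K`, multiplying each homogeneous element of
degree `n` by `n`; it is the derivation with `D(t) = |t|·t` for rooted trees `t`. -/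
noncomputable def DD : Derivation k (HK k) (HK k) :=
  MvPolynomial.mkDerivation k fun T => (T.size : k) • MvPolynomial.X T

/-- The map `B₊ : H_K → k{T}` sending a forest to the tree obtained by attaching
all its roots to a new root vertex. -/
noncomputable def forestTree (d : RTree →₀ ℕ) : RTree :=
  RTree.mk (PlanarTree.node
    (d.support.toList.flatMap fun T => List.replicate (d T) T.rep))

noncomputable def Bplus (p : HK k) : RTree →₀ k :=
  ∑ d ∈ p.support, Finsupp.single (forestTree d) (MvPolynomial.coeff d p)

/-- The inner product on `H_K`. -/
noncomputable def innerHK (u v : HK k) : k := innerT k (Bplus k u) (Bplus k v)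

/-- The degree-`n` homogeneous component of `H_K`. -/
noncomputable abbrev HKcomp (n : ℕ) : Submodule k (HK k) :=
  MvPolynomial.weightedHomogeneousSubmodule k (fun T : RTree => T.size) n

/-- `T_i`: the number of rooted trees with `i+1` vertices. -/
noncomputable def Tcard (i : ℕ) : ℕ := Nat.card {T : RTree // T.size = i + 1}

end Kreimer

open MvPolynomial

namespace PlanarTree

theorem induction_branches {C : PlanarTree → Prop}
    (h : ∀ l, (∀ a ∈ l, C a) → C (node l)) : ∀ p, C p
  | node l => h l fun a _ => induction_branches h a
decreasing_by
  simp only [PlanarTree.node.sizeOf_spec]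
  exact Nat.lt_of_lt_of_le (List.sizeOf_lt_of_mem (by assumption)) (Nat.le_add_left _ _)

theorem Iso.refl (p : PlanarTree) : Iso p p := by
  induction p using induction_branches with
  | h l ih => exact .node (.refl l) (List.forall₂_same.2 ih)

/-- Induction on isomorphisms of planar trees. -/
theorem Iso.induction_branches {C : PlanarTree → PlanarTree → Prop}
    (h : ∀ l m l', l.Perm m → List.Forall₂ (fun a b => Iso a b ∧ C a b) m l' →
      C (.node l) (.node l')) {p q : PlanarTree} (hpq : Iso p q) : C p q := by
  refine Iso.rec (motive_1 := fun p q _ => C p q)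
    (motive_2 := fun m l' _ => List.Forall₂ (fun a b => Iso a b ∧ C a b) m l')
    ?_ ?_ ?_ hpq
  · intro l m l' hp _ ih
    exact h l m l' hp ih
  · exact .nil
  · intro a b l l' hab _ ih ih'
    exact .cons ⟨hab, ih⟩ ih'

theorem size_node (l : List PlanarTree) : (node l).size = 1 + (l.map size).sum := by
  rw [size, List.attach_map_val (f := size)]

theorem Iso.size_eq {p q : PlanarTree} (h : Iso p q) : p.size = q.size := by
  refine Iso.induction_branches (C := fun p q => p.size = q.size) ?_ h
  intro l m l' hp hf
  rw [size_node, size_node, (hp.map size).sum_eq]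
  congr 2
  clear hp
  induction hf with
  | nil => rfl
  | cons hab _ ih => simp [hab.2, ih]

theorem size_pos (p : PlanarTree) : 0 < p.size := by
  cases p; rw [size_node]; omega

end PlanarTree

namespace RTree

open PlanarTree

theorem mk_eq_of_iso {p q : PlanarTree} (h : Iso p q) : mk p = mk q :=
  Quotient.sound (.rel _ _ h)

@[simp]
theorem mk_rep (T : RTree) : mk T.rep = T := Quotient.out_eq T

/-- A function on planar trees that respects `Iso` respects equality of the classes. -/
theorem eq_of_mk_eq {α : Sort*} {f : PlanarTree → α}
    (hf : ∀ p q, Iso p q → f p = f q) {p q : PlanarTree} (h : mk p = mk q) : f p = f q := by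
  have h' : Relation.EqvGen Iso p q := Quotient.exact h
  clear h
  induction h' with
  | rel _ _ h => exact hf _ _ h
  | refl => rfl
  | symm _ _ _ ih => exact ih.symm
  | trans _ _ _ _ _ ih ih' => exact ih.trans ih'

theorem size_mk (p : PlanarTree) : (mk p).size = p.size :=
  eq_of_mk_eq (fun _ _ => Iso.size_eq) (mk_rep _)

theorem mk_eq_bullet_iff {p : PlanarTree} : mk p = bullet ↔ p = node [] := by
  refine ⟨fun h => ?_, fun h => h ▸ rfl⟩
  have hs : p.size = 1 := by
    rw [← size_mk, h, bullet, size_mk, size_node]; rfl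
  obtain ⟨_ | ⟨a, l⟩⟩ := p
  · rfl
  · have := a.size_pos
    simp only [size_node, List.map_cons, List.sum_cons] at hs
    omega

theorem mk_node_perm {l m : List PlanarTree} (h : l.Perm m) : mk (node l) = mk (node m) :=
  mk_eq_of_iso (.node h (List.forall₂_same.2 fun a _ => Iso.refl a))

theorem mk_node_cons {a b : PlanarTree} (h : mk a = mk b) (l : List PlanarTree) :
    mk (node (a :: l)) = mk (node (b :: l)) :=
  eq_of_mk_eq (f := fun a => mk (node (a :: l)))
    (fun _ _ h => mk_eq_of_iso
      (.node (.refl _) (.cons h (List.forall₂_same.2 fun a _ => Iso.refl a)))) h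

theorem mk_node_congr {l l' : List PlanarTree}
    (h : List.Forall₂ (fun a b => mk a = mk b) l l') : mk (node l) = mk (node l') := by
  suffices ∀ s, mk (node (s ++ l)) = mk (node (s ++ l')) from this []
  induction h with
  | nil => exact fun _ => rfl
  | @cons a b l l' hab _ ih =>
    intro s
    rw [mk_node_perm List.perm_middle, mk_node_cons hab, mk_node_perm List.perm_middle.symm]
    simpa using ih (s ++ [b])

/-- Planar representatives of the trees of a forest. -/
noncomputable def forestReps (d : RTree →₀ ℕ) : List PlanarTree :=
  (Finsupp.toMultiset d).toList.map rep

end RTree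

open PlanarTree RTree

section HopfAlgebra

variable (k : Type*) [CommRing k]

/-- The monomial of `H_K` given by a list of planar trees. -/
noncomputable def forestMonomial (l : List PlanarTree) : HK k :=
  (l.map fun a => X (RTree.mk a)).prod

@[simp]
theorem forestMonomial_nil : forestMonomial k [] = 1 := rfl

@[simp]
theorem forestMonomial_cons (a : PlanarTree) (l : List PlanarTree) :
    forestMonomial k (a :: l) = X (RTree.mk a) * forestMonomial k l := by
  simp [forestMonomial]

theorem forestMonomial_perm {l m : List PlanarTree} (h : l.Perm m) :
    forestMonomial k l = forestMonomial k m :=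
  (h.map _).prod_eq

theorem forestMonomial_eq_monomial (l : List PlanarTree) :
    forestMonomial k l =
      monomial (Multiset.toFinsupp (l.map RTree.mk : Multiset RTree)) 1 := by
  induction l with
  | nil => simp
  | cons a l ih =>
    rw [forestMonomial_cons, ih, X, monomial_mul, one_mul, List.map_cons, ← Multiset.cons_coe,
      ← Multiset.singleton_add, map_add, Multiset.toFinsupp_singleton]

theorem monomial_eq_forestMonomial (d : RTree →₀ ℕ) :
    monomial d (1 : k) = forestMonomial k (forestReps d) := by
  rw [forestMonomial_eq_monomial]
  simp [forestReps, Function.comp_def]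

/-- Two linear maps on `H_K` agreeing on all forests are equal. -/
theorem linearMap_ext_forestMonomial {f g : HK k →ₗ[k] HK k}
    (h : ∀ l, f (forestMonomial k l) = g (forestMonomial k l)) : f = g := by
  refine (basisMonomials RTree k).ext fun d => ?_
  simp only [coe_basisMonomials, monomial_eq_forestMonomial, h]

/-- The linear operator on `H_K` joining the trees of a forest to a new common root. -/
noncomputable def joinRoots : HK k →ₗ[k] HK k :=
  (basisMonomials RTree k).constr k fun d => X (RTree.mk (node (forestReps d)))

theorem joinRoots_forestMonomial (l : List PlanarTree) :
    joinRoots k (forestMonomial k l) = X (RTree.mk (node l)) := by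
  have h := (basisMonomials RTree k).constr_basis k
    (fun d => (X (RTree.mk (node (forestReps d))) : HK k))
    (Multiset.toFinsupp (l.map RTree.mk : Multiset RTree))
  rw [coe_basisMonomials] at h
  rw [joinRoots, forestMonomial_eq_monomial, h]
  congr 1
  have hp : (forestReps (Multiset.toFinsupp (l.map RTree.mk : Multiset RTree))).Perm
      ((l.map RTree.mk).map rep) := by
    refine List.Perm.map _ ?_
    rw [Multiset.toFinsupp_toMultiset, ← Multiset.coe_eq_coe, Multiset.coe_toList]
  rw [mk_node_perm hp]
  refine mk_node_congr ?_
  rw [List.map_map, List.forall₂_map_left_iff]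
  exact List.forall₂_same.2 fun a _ => mk_rep _

variable {k}

/-- The extension of a function on planar trees to forests by the Leibniz rule. -/
noncomputable def leibniz (G : PlanarTree → HK k) : List PlanarTree → HK k
  | [] => 0
  | a :: l => G a * forestMonomial k l + X (RTree.mk a) * leibniz G l

theorem leibniz_perm (G : PlanarTree → HK k) {l m : List PlanarTree} (h : l.Perm m) :
    leibniz G l = leibniz G m := by
  induction h with
  | nil => rfl
  | cons a h ih => simp only [leibniz, ih, forestMonomial_perm k h]
  | swap a b l => simp only [leibniz, forestMonomial_cons]; ring
  | trans _ _ ih ih' => exact ih.trans ih'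

theorem derivation_forestMonomial {d : Derivation k (HK k) (HK k)} {G : PlanarTree → HK k}
    {l : List PlanarTree} (h : ∀ a ∈ l, d (X (RTree.mk a)) = G a) :
    d (forestMonomial k l) = leibniz G l := by
  induction l with
  | nil => simp [leibniz]
  | cons a l ih =>
    rw [forestMonomial_cons, d.leibniz, h a (by simp), ih fun b hb => h b (by simp [hb]), leibniz]
    simp only [smul_eq_mul]
    ring

/-- A function on planar trees whose value is determined by the forest of branches and by its
Leibniz extension to that forest is invariant under isomorphism. -/
theorem eq_of_mk_eq_of_leibniz {G : PlanarTree → HK k}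
    (hG : ∀ l l', forestMonomial k l = forestMonomial k l' → leibniz G l = leibniz G l' →
      G (node l) = G (node l')) {p q : PlanarTree} (h : RTree.mk p = RTree.mk q) :
    G p = G q := by
  refine eq_of_mk_eq (fun p q hpq => ?_) h
  refine Iso.induction_branches (C := fun p q => G p = G q) ?_ hpq
  intro l m l' hp hf
  have key : forestMonomial k m = forestMonomial k l' ∧ leibniz G m = leibniz G l' := by
    clear hp
    induction hf with
    | nil => exact ⟨rfl, rfl⟩
    | cons hab _ ih =>
      simp only [leibniz, forestMonomial_cons, ih.1, ih.2, hab.2, mk_eq_of_iso hab.1, and_self]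
  exact hG _ _ ((forestMonomial_perm k hp).trans key.1) ((leibniz_perm G hp).trans key.2)

theorem sum_map_X_node (L : List (List PlanarTree)) :
    ((L.map node).map fun p => (X (RTree.mk p) : HK k)).sum =
      joinRoots k ((L.map (forestMonomial k)).sum) := by
  rw [map_list_sum, List.map_map, List.map_map]
  congr 2
  funext l
  exact (joinRoots_forestMonomial k l).symm

variable (k)

/-- The sum of all trees obtained from a planar tree by growing one vertex. -/
noncomputable def growSum (p : PlanarTree) : HK k :=
  (p.growList.map fun q => X (RTree.mk q)).sum

theorem sum_graftAux (l : List PlanarTree) :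
    ((graftAux (node []) l).map (forestMonomial k)).sum = leibniz (growSum k) l := by
  induction l with
  | nil => simp [graftAux, leibniz]
  | cons a l ih =>
    simp only [graftAux, List.map_append, List.map_map, List.sum_append, leibniz, growSum,
      growList, ← ih, ← List.sum_map_mul_right, ← List.sum_map_mul_left, Function.comp_def,
      forestMonomial_cons]

theorem growSum_node (l : List PlanarTree) :
    growSum k (node l) =
      joinRoots k (X bullet * forestMonomial k l) + joinRoots k (leibniz (growSum k) l) := by
  rw [growSum, growList, graftList, List.map_cons, List.sum_cons, sum_map_X_node, sum_graftAux,
    bullet, ← forestMonomial_cons, joinRoots_forestMonomial]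

theorem ND_X_mk (p : PlanarTree) : ND k (X (RTree.mk p)) = growSum k p := by
  have h : ∀ T, ND k (X T) = growSum k T.rep := fun T => by
    simp only [ND, mkDerivation_X, growF, growSum, map_list_sum, List.map_map]
    congr 2
    funext q
    simp [toHK]
  rw [h]
  refine eq_of_mk_eq_of_leibniz (fun l l' h₁ h₂ => ?_) (mk_rep _)
  rw [growSum_node, growSum_node, h₁, h₂]

/-- The value of the pruning derivation on a planar tree. -/
noncomputable def pruneSum (p : PlanarTree) : HK k :=
  if p = node [] then 1 else (p.pruneList.map fun q => X (RTree.mk q)).sum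

theorem sum_pruneAux (l : List PlanarTree) :
    ((pruneAux l).map (forestMonomial k)).sum = leibniz (pruneSum k) l := by
  induction l with
  | nil => simp [pruneAux, leibniz]
  | cons a l ih =>
    obtain ⟨_ | ⟨b, m⟩⟩ := a <;>
    simp [pruneAux, leibniz, pruneSum, pruneList, ← ih, List.sum_map_mul_right,
      List.sum_map_mul_left, Function.comp_def, add_mul, add_assoc]

theorem pruneSum_node (l : List PlanarTree) :
    pruneSum k (node l) =
      joinRoots k (leibniz (pruneSum k) l) + C (constantCoeff (forestMonomial k l)) := by
  cases l with
  | nil => simp [pruneSum, leibniz]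
  | cons a l =>
    rw [pruneSum, if_neg (by simp), pruneList, sum_map_X_node, sum_pruneAux]
    simp

theorem PD_X_mk (p : PlanarTree) : PD k (X (RTree.mk p)) = pruneSum k p := by
  have h : ∀ T, PD k (X T) = pruneSum k T.rep := fun T => by
    have hT : T = bullet ↔ T.rep = node [] := by rw [← mk_eq_bullet_iff, mk_rep]
    simp only [PD, mkDerivation_X, pruneF, pruneSum, map_list_sum, List.map_map, hT]
    congr 3
    funext q
    simp [toHK]
  rw [h]
  refine eq_of_mk_eq_of_leibniz (fun l l' h₁ h₂ => ?_) (mk_rep _)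
  rw [pruneSum_node, pruneSum_node, h₁, h₂]

theorem DD_X_mk (p : PlanarTree) :
    DD k (X (RTree.mk p)) = (p.size : k) • X (RTree.mk p) := by
  rw [DD, mkDerivation_X, size_mk]

theorem DD_forestMonomial (l : List PlanarTree) :
    DD k (forestMonomial k l) = ((l.map PlanarTree.size).sum : k) • forestMonomial k l := by
  induction l with
  | nil => simp
  | cons a l ih =>
    rw [forestMonomial_cons, Derivation.leibniz, ih, DD_X_mk]
    simp only [smul_eq_mul, smul_eq_C_mul, List.map_cons, List.sum_cons, Nat.cast_add, C_add]
    ring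

theorem ND_joinRoots (u : HK k) :
    ND k (joinRoots k u) = joinRoots k (X bullet * u) + joinRoots k (ND k u) := by
  have h : (ND k).toLinearMap ∘ₗ joinRoots k =
      joinRoots k ∘ₗ LinearMap.mulLeft k (X bullet) + joinRoots k ∘ₗ (ND k).toLinearMap := by
    refine linearMap_ext_forestMonomial k fun l => ?_
    simp [joinRoots_forestMonomial, ND_X_mk, growSum_node,
      derivation_forestMonomial fun a _ => ND_X_mk k a]
  exact LinearMap.congr_fun h u

theorem PD_joinRoots (u : HK k) :
    PD k (joinRoots k u) = joinRoots k (PD k u) + C (constantCoeff u) := by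
  have h : (PD k).toLinearMap ∘ₗ joinRoots k =
      joinRoots k ∘ₗ (PD k).toLinearMap +
        Algebra.linearMap k (HK k) ∘ₗ (aeval fun _ => (0 : k)).toLinearMap := by
    refine linearMap_ext_forestMonomial k fun l => ?_
    simp [joinRoots_forestMonomial, PD_X_mk, pruneSum_node,
      derivation_forestMonomial fun a _ => PD_X_mk k a]
  simpa using LinearMap.congr_fun h u

theorem DD_joinRoots (u : HK k) :
    DD k (joinRoots k u) = joinRoots k u + joinRoots k (DD k u) := by
  have h : (DD k).toLinearMap ∘ₗ joinRoots k =
      joinRoots k + joinRoots k ∘ₗ (DD k).toLinearMap := by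
    refine linearMap_ext_forestMonomial k fun l => ?_
    simp [joinRoots_forestMonomial, DD_X_mk, DD_forestMonomial, size_node, add_smul]
  exact LinearMap.congr_fun h u

theorem constantCoeff_ND (u : HK k) : constantCoeff (ND k u) = 0 := by
  induction u using MvPolynomial.induction_on with
  | C a => simp
  | add p q hp hq => simp [hp, hq]
  | mul_X p T hp =>
    have hT : constantCoeff (ND k (X T)) = 0 := by
      rw [← mk_rep T, ND_X_mk, growSum, map_list_sum, List.map_map]
      simp [Function.comp_def]
    simp [hp, hT]

theorem commutator_joinRoots (u : HK k) :
    ⁅PD k, ND k⁆ (joinRoots k u) = joinRoots k u + joinRoots k (⁅PD k, ND k⁆ u) := by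
  have hb : PD k (X bullet) = 1 := by
    rw [bullet, PD_X_mk, pruneSum, if_pos rfl]
  simp only [Derivation.commutator_apply, ND_joinRoots, PD_joinRoots, map_add, map_sub,
    Derivation.leibniz, hb, constantCoeff_ND, smul_eq_mul, mul_one, map_mul, constantCoeff_X,
    zero_mul, C_0, derivation_C]
  ring

theorem commutator_PD_ND : ⁅PD k, ND k⁆ = DD k := by
  refine MvPolynomial.derivation_ext fun T => ?_
  rw [← mk_rep T]
  induction T.rep using PlanarTree.induction_branches with
  | h l ih =>
    rw [← joinRoots_forestMonomial, commutator_joinRoots, DD_joinRoots,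
      derivation_forestMonomial ih, derivation_forestMonomial fun a _ => rfl]

end HopfAlgebra

/-- On `H_K`, `[P,N] = D`. -/
theorem stmt13 (k : Type*) [Field k] [CharZero k] (u : HK k) :
    PD k (ND k u) - ND k (PD k u) = DD k u := by
  rw [← commutator_PD_ND, Derivation.commutator_apply]
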